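/- arXiv:2309.12799 — 4 statements merged into one kernel-verified Lean document; each statement's English description precedes it below -/
import Mathlib

section
/- Holley inequality (continuum version): Let E be a finite set, for each e ∈ E let ρ_e be a finite Borel measure on (0,∞), and let ρ = ⊗_{e∈E} ρ_e be the product measure on S = (0,∞)^E. Let μ₁ = s₁·ρ and μ₂ = s₂·ρ be two probability measures on S with measurable densities s₁, s₂ ≥ 0. If s₂(κ ∨ κ′)·s₁(κ ∧ κ′) ≥ s₁(κ)·s₂(κ′) for all κ, κ′ ∈ S, then μ₁ is stochastically dominated by μ₂, i.e., ∫ f dμ₁ ≤ ∫ f dμ₂ for every bounded measurable increasing function f : S → ℝ. -/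
open MeasureTheory

/-- If `a, b ≤ A` and `a * b ≤ A * B`, then `a + b ≤ A + B`. -/
lemma ENNReal.add_le_add_of_mul_le_mul {a b A B : ENNReal} (ha : a ≤ A) (hb : b ≤ A)
    (hab : a * b ≤ A * B) : a + b ≤ A + B := by
  rcases eq_or_ne A ⊤ with rfl | hA
  · simp
  rcases eq_or_ne B ⊤ with rfl | hB
  · simp
  lift a to NNReal using ne_top_of_le_ne_top hA ha
  lift b to NNReal using ne_top_of_le_ne_top hA hb
  lift A to NNReal using hA
  lift B to NNReal using hB
  norm_cast at *
  rw [← NNReal.coe_le_coe] at *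
  push_cast at *
  rcases eq_or_lt_of_le A.coe_nonneg with h0 | h0
  · linarith [B.coe_nonneg]
  · by_contra! h
    nlinarith [mul_nonneg (sub_nonneg.2 ha) (sub_nonneg.2 hb), mul_lt_mul_of_pos_left h h0]

/-- The **four functions theorem** for a measure on a linear order. -/
lemma lintegral_mul_lintegral_le_of_sup_inf {α : Type*} [LinearOrder α] [MeasurableSpace α]
    (μ : Measure α) [SFinite μ] {f₁ f₂ f₃ f₄ : α → ENNReal}
    (h₁ : Measurable f₁) (h₂ : Measurable f₂) (h₃ : Measurable f₃) (h₄ : Measurable f₄)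
    (h : ∀ x y, f₁ x * f₂ y ≤ f₃ (x ⊔ y) * f₄ (x ⊓ y)) :
    (∫⁻ x, f₁ x ∂μ) * (∫⁻ x, f₂ x ∂μ) ≤ (∫⁻ x, f₃ x ∂μ) * ∫⁻ x, f₄ x ∂μ := by
  have symmetrize : ∀ {g k : α → ENNReal}, Measurable g → Measurable k →
      2 * ((∫⁻ x, g x ∂μ) * ∫⁻ x, k x ∂μ) =
        ∫⁻ z, (g z.1 * k z.2 + k z.1 * g z.2) ∂(μ.prod μ) := by
    intro g k hg hk
    rw [lintegral_add_left (by fun_prop), lintegral_prod_mul hg.aemeasurable hk.aemeasurable,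
      lintegral_prod_mul hk.aemeasurable hg.aemeasurable, two_mul,
      mul_comm (∫⁻ x, k x ∂μ)]
  have ordered : ∀ x y, y ≤ x →
      f₁ x * f₂ y + f₂ x * f₁ y ≤ f₃ x * f₄ y + f₄ x * f₃ y := by
    intro x y hxy
    apply ENNReal.add_le_add_of_mul_le_mul
    · simpa [hxy] using h x y
    · simpa [hxy, mul_comm] using h y x
    · calc f₁ x * f₂ y * (f₂ x * f₁ y) = (f₁ x * f₂ x) * (f₁ y * f₂ y) := by ring
        _ ≤ (f₃ x * f₄ x) * (f₃ y * f₄ y) := by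
          exact mul_le_mul' (by simpa using h x x) (by simpa using h y y)
        _ = f₃ x * f₄ y * (f₄ x * f₃ y) := by ring
  rw [← ENNReal.mul_le_mul_iff_right (a := 2) (by norm_num) (by norm_num),
    symmetrize h₁ h₂, symmetrize h₃ h₄]
  refine lintegral_mono fun z => ?_
  rcases le_total z.2 z.1 with hz | hz
  · exact ordered _ _ hz
  · convert ordered _ _ hz using 1 <;> ring

/-- The **four functions theorem** for marginals of a product measure. -/
lemma lmarginal_mul_lmarginal_le_of_sup_inf {ι : Type*} [DecidableEq ι] {X : ι → Type*}
    [∀ i, LinearOrder (X i)] [∀ i, MeasurableSpace (X i)]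
    (μ : ∀ i, Measure (X i)) [∀ i, SigmaFinite (μ i)] (s : Finset ι)
    {f₁ f₂ f₃ f₄ : (∀ i, X i) → ENNReal}
    (h₁ : Measurable f₁) (h₂ : Measurable f₂) (h₃ : Measurable f₃) (h₄ : Measurable f₄)
    (h : ∀ x y, f₁ x * f₂ y ≤ f₃ (x ⊔ y) * f₄ (x ⊓ y)) (x y : ∀ i, X i) :
    lmarginal μ s f₁ x * lmarginal μ s f₂ y ≤
      lmarginal μ s f₃ (x ⊔ y) * lmarginal μ s f₄ (x ⊓ y) := by
  induction s using Finset.induction_on generalizing f₁ f₂ f₃ f₄ with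
  | empty => simpa using h x y
  | insert i s hi ih =>
    have marginal_measurable : ∀ {g : (∀ i, X i) → ENNReal}, Measurable g →
        Measurable fun x => ∫⁻ t, g (Function.update x i t) ∂μ i := by
      intro g hg
      simpa [← lmarginal_singleton] using hg.lmarginal μ (s := {i})
    rw [lmarginal_insert' _ h₁ hi, lmarginal_insert' _ h₂ hi, lmarginal_insert' _ h₃ hi,
      lmarginal_insert' _ h₄ hi]
    refine ih (marginal_measurable h₁) (marginal_measurable h₂) (marginal_measurable h₃)
      (marginal_measurable h₄) fun x y => ?_
    refine lintegral_mul_lintegral_le_of_sup_inf (μ i) (h₁.comp (measurable_update x))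
      (h₂.comp (measurable_update y)) (h₃.comp (measurable_update _))
      (h₄.comp (measurable_update _)) fun t u => ?_
    convert h (Function.update x i t) (Function.update y i u) using 3 <;>
    · funext j
      obtain rfl | hji := eq_or_ne j i <;> simp [Function.update_of_ne, *]

/-- The **four functions theorem** for a product measure. -/
lemma lintegral_pi_mul_lintegral_pi_le_of_sup_inf {ι : Type*} [Fintype ι] {X : ι → Type*}
    [∀ i, LinearOrder (X i)] [∀ i, MeasurableSpace (X i)]
    (μ : ∀ i, Measure (X i)) [∀ i, SigmaFinite (μ i)]
    {f₁ f₂ f₃ f₄ : (∀ i, X i) → ENNReal}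
    (h₁ : Measurable f₁) (h₂ : Measurable f₂) (h₃ : Measurable f₃) (h₄ : Measurable f₄)
    (h : ∀ x y, f₁ x * f₂ y ≤ f₃ (x ⊔ y) * f₄ (x ⊓ y)) :
    (∫⁻ x, f₁ x ∂Measure.pi μ) * (∫⁻ x, f₂ x ∂Measure.pi μ) ≤
      (∫⁻ x, f₃ x ∂Measure.pi μ) * ∫⁻ x, f₄ x ∂Measure.pi μ := by
  classical
  rcases isEmpty_or_nonempty (∀ i, X i) with hX | ⟨⟨x⟩⟩
  · simp
  · simpa only [lmarginal_univ] using
      lmarginal_mul_lmarginal_le_of_sup_inf μ Finset.univ h₁ h₂ h₃ h₄ h x x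

/-- **Holley inequality (continuum version).**
`E` is a finite set, each `ρ e` a finite Borel measure on `(0,∞)` (encoded as a measure
on `ℝ` giving no mass to the complement of `(0,∞)`), and `ρ = ⊗ ρ_e` the product measure
on `S = (0,∞)^E`.  If the probability measures `μ₁ = s₁·ρ`, `μ₂ = s₂·ρ` satisfy the
Holley condition `s₂(κ ⊔ κ')·s₁(κ ⊓ κ') ≥ s₁(κ)·s₂(κ')` on `S`, then `μ₁` is
stochastically dominated by `μ₂`. -/
theorem holley_inequality
    {E : Type*} [Fintype E]
    (ρ : E → Measure ℝ) [∀ e, IsFiniteMeasure (ρ e)]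
    (hρsupp : ∀ e, ρ e (Set.Ioi (0 : ℝ))ᶜ = 0)
    (s₁ s₂ : (E → ℝ) → ℝ)
    (hs₁meas : Measurable s₁) (hs₂meas : Measurable s₂)
    (hs₁nonneg : ∀ κ, 0 ≤ s₁ κ) (hs₂nonneg : ∀ κ, 0 ≤ s₂ κ)
    (μ₁ μ₂ : Measure (E → ℝ))
    (hμ₁ : μ₁ = (Measure.pi ρ).withDensity fun κ => ENNReal.ofReal (s₁ κ))
    (hμ₂ : μ₂ = (Measure.pi ρ).withDensity fun κ => ENNReal.ofReal (s₂ κ))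
    [IsProbabilityMeasure μ₁] [IsProbabilityMeasure μ₂]
    (hHolley : ∀ κ κ' : E → ℝ, (∀ e, 0 < κ e) → (∀ e, 0 < κ' e) →
      s₁ κ * s₂ κ' ≤ s₂ (κ ⊔ κ') * s₁ (κ ⊓ κ'))
    (f : (E → ℝ) → ℝ) (hfmeas : Measurable f)
    (hfbdd : ∃ C : ℝ, ∀ κ, |f κ| ≤ C)
    (hfmono : ∀ κ κ' : E → ℝ, (∀ e, 0 < κ e) → (∀ e, 0 < κ' e) → κ ≤ κ' → f κ ≤ f κ') :
    ∫ κ, f κ ∂μ₁ ≤ ∫ κ, f κ ∂μ₂ := by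
  obtain ⟨C, hC⟩ := hfbdd
  set ν := Measure.pi ρ
  set P : Set (E → ℝ) := {κ | ∀ e, 0 < κ e} with hP
  have hPmeas : MeasurableSet P := by
    simp only [hP, Set.ofPred_forall]
    exact MeasurableSet.iInter fun e => measurableSet_lt measurable_const (measurable_pi_apply e)
  have hPae : ∀ᵐ κ ∂ν, κ ∈ P :=
    ae_all_iff.2 fun e => (Measure.tendsto_eval_ae_ae (i := e)).eventually (mem_ae_iff.2 (hρsupp e))
  have lintegral_indicator_P (g : (E → ℝ) → ENNReal) :
      ∫⁻ κ, P.indicator g κ ∂ν = ∫⁻ κ, g κ ∂ν :=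
    lintegral_congr_ae <| hPae.mono fun κ hκ => Set.indicator_of_mem hκ g
  set F : (E → ℝ) → ENNReal := fun κ => ENNReal.ofReal (f κ + C)
  have hFmeas : Measurable F := by fun_prop
  set t₁ : (E → ℝ) → ENNReal := fun κ => ENNReal.ofReal (s₁ κ) with ht₁
  set t₂ : (E → ℝ) → ENNReal := fun κ => ENNReal.ofReal (s₂ κ) with ht₂
  have ht₁meas : Measurable t₁ := by fun_prop
  have ht₂meas : Measurable t₂ := by fun_prop
  have hmass₁ : ∫⁻ κ, t₁ κ ∂ν = 1 := by
    rw [← setLIntegral_univ, ← withDensity_apply _ MeasurableSet.univ, ← hμ₁, measure_univ]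
  have hmass₂ : ∫⁻ κ, t₂ κ ∂ν = 1 := by
    rw [← setLIntegral_univ, ← withDensity_apply _ MeasurableSet.univ, ← hμ₂, measure_univ]
  have hlintegral : ∫⁻ κ, F κ ∂μ₁ ≤ ∫⁻ κ, F κ ∂μ₂ := by
    rw [hμ₁, hμ₂, lintegral_withDensity_eq_lintegral_mul _ ht₁meas hFmeas,
      lintegral_withDensity_eq_lintegral_mul _ ht₂meas hFmeas]
    have key := lintegral_pi_mul_lintegral_pi_le_of_sup_inf ρ
      (f₁ := P.indicator (t₁ * F)) (f₂ := P.indicator t₂)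
      (f₃ := P.indicator (t₂ * F)) (f₄ := P.indicator t₁)
      ((ht₁meas.mul hFmeas).indicator hPmeas) (ht₂meas.indicator hPmeas)
      ((ht₂meas.mul hFmeas).indicator hPmeas) (ht₁meas.indicator hPmeas) ?_
    · simpa only [ν, lintegral_indicator_P, hmass₁, hmass₂, mul_one] using key
    · intro x y
      by_cases hx : x ∈ P
      swap
      · simp [hx]
      by_cases hy : y ∈ P
      swap
      · simp [hy]
      have hsup : x ⊔ y ∈ P := fun e => lt_sup_of_lt_left (hx e)
      have hinf : x ⊓ y ∈ P := fun e => lt_inf_iff.2 ⟨hx e, hy e⟩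
      simp only [Set.indicator_of_mem, hx, hy, hsup, hinf, Pi.mul_apply]
      calc t₁ x * F x * t₂ y = t₁ x * t₂ y * F x := by ring
        _ ≤ t₂ (x ⊔ y) * t₁ (x ⊓ y) * F (x ⊔ y) := by
          refine mul_le_mul' ?_ (ENNReal.ofReal_le_ofReal ?_)
          · simp only [ht₁, ht₂]
            rw [← ENNReal.ofReal_mul (hs₁nonneg _), ← ENNReal.ofReal_mul (hs₂nonneg _)]
            exact ENNReal.ofReal_le_ofReal (hHolley x y hx hy)
          · linarith [hfmono x (x ⊔ y) hx hsup le_sup_left]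
        _ = t₂ (x ⊔ y) * F (x ⊔ y) * t₁ (x ⊓ y) := by ring
  have hf_integrable (μ : Measure (E → ℝ)) [IsProbabilityMeasure μ] : Integrable f μ :=
    Integrable.of_bound hfmeas.aestronglyMeasurable C (ae_of_all _ hC)
  have hnonneg (κ : E → ℝ) : 0 ≤ f κ + C := by linarith [neg_le_of_abs_le (hC κ)]
  have hshift (μ : Measure (E → ℝ)) [IsProbabilityMeasure μ] :
      ENNReal.ofReal ((∫ κ, f κ ∂μ) + C) = ∫⁻ κ, F κ ∂μ := by
    have hf_add_integrable : Integrable (fun κ => f κ + C) μ :=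
      (hf_integrable μ).add (integrable_const C)
    rw [← ofReal_integral_eq_lintegral_ofReal hf_add_integrable (ae_of_all _ hnonneg),
      integral_add (hf_integrable μ) (integrable_const C)]
    simp
  rw [← hshift μ₁, ← hshift μ₂] at hlintegral
  have hnonneg₂ : 0 ≤ (∫ κ, f κ ∂μ₂) + C := by
    have := integral_nonneg_of_ae (ae_of_all μ₂ hnonneg)
    rw [integral_add (hf_integrable μ₂) (integrable_const C)] at this
    simpa using this
  linarith [(ENNReal.ofReal_le_ofReal_iff hnonneg₂).1 hlintegral]
end

section
/- FKG inequality from the lattice condition: Let E be a finite set, for each e ∈ E let ρ_e be a finite Borel measure on (0,∞), and let ρ = ⊗_{e∈E} ρ_e be the product measure on S = (0,∞)^E. Let μ = s·ρ be a probability measure whose measurable density s ≥ 0 satisfies the lattice condition s(κ ∨ κ′)·s(κ ∧ κ′) ≥ s(κ)·s(κ′) for all κ, κ′ ∈ S. Then for all increasing measurable functions X, Y : S → ℝ such that X, Y, and XY are μ-integrable, μ(XY) ≥ μ(X)·μ(Y). -/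
open MeasureTheory

open scoped ENNReal

theorem ENNReal.add_le_add_of_mul_le_mul_s1 {a b M m : ℝ≥0∞} (ha : a ≤ M) (hb : b ≤ M)
    (h : a * b ≤ M * m) : a + b ≤ M + m := by
  rcases eq_or_ne M ⊤ with rfl | hM
  · simp
  rcases eq_or_ne m ⊤ with rfl | hm
  · simp
  lift M to NNReal using hM
  lift m to NNReal using hm
  lift a to NNReal using ne_top_of_le_ne_top ENNReal.coe_ne_top ha
  lift b to NNReal using ne_top_of_le_ne_top ENNReal.coe_ne_top hb
  norm_cast at *
  rw [← NNReal.coe_le_coe] at *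
  push_cast at *
  rcases eq_or_lt_of_le M.coe_nonneg with h0 | h0
  · linarith [m.coe_nonneg]
  · refine le_of_mul_le_mul_left ?_ h0
    nlinarith [mul_nonneg (sub_nonneg.2 ha) (sub_nonneg.2 hb)]

namespace MeasureTheory

/-- The four functions theorem for integrals over a linear order. -/
theorem four_functions_lintegral {α : Type*} [LinearOrder α] [MeasurableSpace α]
    (ρ : Measure α) {f₁ f₂ f₃ f₄ : α → ℝ≥0∞}
    (h₁ : Measurable f₁) (h₂ : Measurable f₂) (h₃ : Measurable f₃) (h₄ : Measurable f₄)
    (h : ∀ x y, f₁ x * f₂ y ≤ f₃ (x ⊔ y) * f₄ (x ⊓ y)) :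
    (∫⁻ x, f₁ x ∂ρ) * ∫⁻ x, f₂ x ∂ρ ≤ (∫⁻ x, f₃ x ∂ρ) * ∫⁻ x, f₄ x ∂ρ := by
  have double {f g : α → ℝ≥0∞} (hf : Measurable f) (hg : Measurable g) :
      ∫⁻ x, ∫⁻ y, (f x * g y + f y * g x) ∂ρ ∂ρ
        = 2 * ((∫⁻ x, f x ∂ρ) * ∫⁻ x, g x ∂ρ) := by
    have hx (x : α) : ∫⁻ y, (f x * g y + f y * g x) ∂ρ
        = f x * (∫⁻ y, g y ∂ρ) + (∫⁻ y, f y ∂ρ) * g x := by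
      rw [lintegral_add_left (hg.const_mul _), lintegral_const_mul _ hg,
        lintegral_mul_const _ hf]
    simp_rw [hx]
    rw [lintegral_add_left (hf.mul_const _), lintegral_mul_const _ hf,
      lintegral_const_mul _ hg, two_mul]
  have pointwise (x y : α) : f₁ x * f₂ y + f₁ y * f₂ x ≤ f₃ x * f₄ y + f₃ y * f₄ x := by
    have hxx := h x x
    have hyy := h y y
    simp only [sup_idem, inf_idem] at hxx hyy
    have hprod : f₁ x * f₂ y * (f₁ y * f₂ x) ≤ f₃ x * f₄ y * (f₃ y * f₄ x) :=
      calc _ = f₁ x * f₂ x * (f₁ y * f₂ y) := by ring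
        _ ≤ f₃ x * f₄ x * (f₃ y * f₄ y) := mul_le_mul' hxx hyy
        _ = _ := by ring
    have hxy := h x y
    have hyx := h y x
    rcases le_total x y with hle | hle
    · simp only [sup_eq_right.2 hle, sup_eq_left.2 hle, inf_eq_left.2 hle,
        inf_eq_right.2 hle] at hxy hyx
      rw [add_comm (f₃ x * f₄ y)]
      exact ENNReal.add_le_add_of_mul_le_mul_s1 hxy hyx (hprod.trans_eq (mul_comm _ _))
    · simp only [sup_eq_right.2 hle, sup_eq_left.2 hle, inf_eq_left.2 hle,
        inf_eq_right.2 hle] at hxy hyx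
      exact ENNReal.add_le_add_of_mul_le_mul_s1 hxy hyx hprod
  have key := lintegral_mono (μ := ρ) fun x ↦ lintegral_mono (μ := ρ) fun y ↦ pointwise x y
  rw [double h₁ h₂, double h₃ h₄] at key
  exact (ENNReal.mul_le_mul_iff_right two_ne_zero ENNReal.ofNat_ne_top).1 key

section Pi

variable {ι : Type*} {π : ι → Type*} [∀ i, LinearOrder (π i)] [∀ i, MeasurableSpace (π i)]

/-- Marginals preserve the hypothesis of the four functions theorem. -/
theorem four_functions_lmarginal [DecidableEq ι] (ρ : ∀ i, Measure (π i))
    [∀ i, SigmaFinite (ρ i)] {f₁ f₂ f₃ f₄ : (∀ i, π i) → ℝ≥0∞}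
    (h₁ : Measurable f₁) (h₂ : Measurable f₂) (h₃ : Measurable f₃) (h₄ : Measurable f₄)
    (h : ∀ x y, f₁ x * f₂ y ≤ f₃ (x ⊔ y) * f₄ (x ⊓ y)) (t : Finset ι) (x y : ∀ i, π i) :
    (∫⋯∫⁻_t, f₁ ∂ρ) x * (∫⋯∫⁻_t, f₂ ∂ρ) y
      ≤ (∫⋯∫⁻_t, f₃ ∂ρ) (x ⊔ y) * (∫⋯∫⁻_t, f₄ ∂ρ) (x ⊓ y) := by
  induction t using Finset.induction_on generalizing x y with
  | empty => simpa using h x y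
  | insert i t hi ih =>
    have hm {f : (∀ i, π i) → ℝ≥0∞} (hf : Measurable f) (z : ∀ i, π i) :
        Measurable fun a ↦ (∫⋯∫⁻_t, f ∂ρ) (Function.update z i a) :=
      (hf.lmarginal ρ).comp (measurable_update z)
    rw [lmarginal_insert _ h₁ hi, lmarginal_insert _ h₂ hi, lmarginal_insert _ h₃ hi,
      lmarginal_insert _ h₄ hi]
    refine four_functions_lintegral (ρ i) (hm h₁ x) (hm h₂ y) (hm h₃ _) (hm h₄ _)
      fun a b ↦ ?_
    have hsup : Function.update (x ⊔ y) i (a ⊔ b)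
        = Function.update x i a ⊔ Function.update y i b := by
      ext j
      obtain rfl | hj := eq_or_ne j i <;> simp [*]
    have hinf : Function.update (x ⊓ y) i (a ⊓ b)
        = Function.update x i a ⊓ Function.update y i b := by
      ext j
      obtain rfl | hj := eq_or_ne j i <;> simp [*]
    rw [hsup, hinf]
    exact ih _ _

variable [Fintype ι]

/-- The four functions theorem for integrals over a finite product of linear orders. -/
theorem four_functions_lintegral_pi (ρ : ∀ i, Measure (π i))
    [∀ i, SigmaFinite (ρ i)] {f₁ f₂ f₃ f₄ : (∀ i, π i) → ℝ≥0∞}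
    (h₁ : Measurable f₁) (h₂ : Measurable f₂) (h₃ : Measurable f₃) (h₄ : Measurable f₄)
    (h : ∀ x y, f₁ x * f₂ y ≤ f₃ (x ⊔ y) * f₄ (x ⊓ y)) :
    (∫⁻ x, f₁ x ∂Measure.pi ρ) * ∫⁻ x, f₂ x ∂Measure.pi ρ
      ≤ (∫⁻ x, f₃ x ∂Measure.pi ρ) * ∫⁻ x, f₄ x ∂Measure.pi ρ := by
  classical
  rcases isEmpty_or_nonempty (∀ i, π i) with hemp | ⟨⟨x⟩⟩
  · simp
  · simpa [lmarginal_univ] using four_functions_lmarginal ρ h₁ h₂ h₃ h₄ h Finset.univ x x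

/-- The FKG inequality for `ℝ≥0∞`-valued functions. -/
theorem fkg_lintegral_withDensity (ρ : ∀ i, Measure (π i))
    [∀ i, SigmaFinite (ρ i)] {w X Y : (∀ i, π i) → ℝ≥0∞}
    (hw : Measurable w) (hX : Measurable X) (hY : Measurable Y)
    (hlattice : ∀ x y, w x * w y ≤ w (x ⊔ y) * w (x ⊓ y))
    (hXmono : MonotoneOn X (Function.support w))
    (hYmono : MonotoneOn Y (Function.support w))
    [IsProbabilityMeasure ((Measure.pi ρ).withDensity w)] :
    (∫⁻ x, X x ∂(Measure.pi ρ).withDensity w) * ∫⁻ x, Y x ∂(Measure.pi ρ).withDensity w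
      ≤ ∫⁻ x, X x * Y x ∂(Measure.pi ρ).withDensity w := by
  have hone : ∫⁻ x, w x ∂Measure.pi ρ = 1 := by
    rw [← setLIntegral_univ, ← withDensity_apply _ MeasurableSet.univ, measure_univ]
  have hXY : Measurable fun x ↦ X x * Y x := hX.mul hY
  rw [lintegral_withDensity_eq_lintegral_mul _ hw hX,
    lintegral_withDensity_eq_lintegral_mul _ hw hY,
    lintegral_withDensity_eq_lintegral_mul _ hw hXY]
  refine (four_functions_lintegral_pi ρ (hw.mul hX) (hw.mul hY) (hw.mul hXY) hw
    fun x y ↦ ?_).trans_eq (by rw [hone, mul_one])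
  simp only [Pi.mul_apply]
  rcases eq_or_ne (w x) 0 with hx | hx
  · simp [hx]
  rcases eq_or_ne (w y) 0 with hy | hy
  · simp [hy]
  have hsup : w (x ⊔ y) ≠ 0 := fun h0 ↦ by
    simpa [h0, hx, hy] using hlattice x y
  calc w x * X x * (w y * Y y) = w x * w y * (X x * Y y) := by ring
    _ ≤ w (x ⊔ y) * w (x ⊓ y) * (X (x ⊔ y) * Y (x ⊔ y)) :=
      mul_le_mul' (hlattice x y)
        (mul_le_mul' (hXmono hx hsup le_sup_left) (hYmono hy hsup le_sup_right))
    _ = _ := by ring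

/-- The FKG inequality for real functions that are bounded below. -/
theorem fkg_integral_withDensity_of_le (ρ : ∀ i, Measure (π i))
    [∀ i, SigmaFinite (ρ i)] {w : (∀ i, π i) → ℝ≥0∞} {X Y : (∀ i, π i) → ℝ} {c : ℝ}
    (hw : Measurable w) (hX : Measurable X) (hY : Measurable Y)
    (hlattice : ∀ x y, w x * w y ≤ w (x ⊔ y) * w (x ⊓ y))
    (hXmono : MonotoneOn X (Function.support w))
    (hYmono : MonotoneOn Y (Function.support w))
    (hXc : ∀ x, c ≤ X x) (hYc : ∀ x, c ≤ Y x)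
    [IsProbabilityMeasure ((Measure.pi ρ).withDensity w)]
    (hXint : Integrable X ((Measure.pi ρ).withDensity w))
    (hYint : Integrable Y ((Measure.pi ρ).withDensity w))
    (hXYint : Integrable (fun x ↦ X x * Y x) ((Measure.pi ρ).withDensity w)) :
    (∫ x, X x ∂(Measure.pi ρ).withDensity w) * ∫ x, Y x ∂(Measure.pi ρ).withDensity w
      ≤ ∫ x, X x * Y x ∂(Measure.pi ρ).withDensity w := by
  have key := fkg_lintegral_withDensity ρ hw (hX.sub_const c).ennreal_ofReal
    (hY.sub_const c).ennreal_ofReal hlattice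
    (fun x hx y hy hxy ↦ ENNReal.ofReal_le_ofReal (sub_le_sub_right (hXmono hx hy hxy) c))
    (fun x hx y hy hxy ↦ ENNReal.ofReal_le_ofReal (sub_le_sub_right (hYmono hx hy hxy) c))
  set μ := (Measure.pi ρ).withDensity w
  have hX0 (x) : 0 ≤ X x - c := sub_nonneg.2 (hXc x)
  have hY0 (x) : 0 ≤ Y x - c := sub_nonneg.2 (hYc x)
  have hXi : Integrable (fun x ↦ X x - c) μ := hXint.sub (integrable_const c)
  have hYi : Integrable (fun x ↦ Y x - c) μ := hYint.sub (integrable_const c)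
  have hexp : (fun x ↦ (X x - c) * (Y x - c))
      = fun x ↦ X x * Y x - c * X x - c * (Y x - c) := by
    ext x; ring
  have hi₁ : Integrable (fun x ↦ X x * Y x - c * X x) μ := hXYint.sub (hXint.const_mul c)
  have hXYi : Integrable (fun x ↦ (X x - c) * (Y x - c)) μ := by
    rw [hexp]
    exact hi₁.sub (hYi.const_mul c)
  simp_rw [← ENNReal.ofReal_mul (hX0 _)] at key
  rw [← ofReal_integral_eq_lintegral_ofReal hXi (ae_of_all _ hX0),
    ← ofReal_integral_eq_lintegral_ofReal hYi (ae_of_all _ hY0),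
    ← ofReal_integral_eq_lintegral_ofReal hXYi
      (ae_of_all _ fun x ↦ mul_nonneg (hX0 x) (hY0 x)),
    ← ENNReal.ofReal_mul (integral_nonneg hX0),
    ENNReal.ofReal_le_ofReal_iff (integral_nonneg fun x ↦ mul_nonneg (hX0 x) (hY0 x)),
    hexp, integral_sub hi₁ (hYi.const_mul c), integral_sub hXYint (hXint.const_mul c),
    integral_const_mul, integral_const_mul, integral_sub hXint (integrable_const c),
    integral_sub hYint (integrable_const c)] at key
  simp only [integral_const, probReal_univ, one_smul] at key
  linarith

/-- The FKG inequality for a finite product of linear orders. -/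
theorem fkg_integral_withDensity (ρ : ∀ i, Measure (π i))
    [∀ i, SigmaFinite (ρ i)] {w : (∀ i, π i) → ℝ≥0∞} {X Y : (∀ i, π i) → ℝ}
    (hw : Measurable w) (hX : Measurable X) (hY : Measurable Y)
    (hlattice : ∀ x y, w x * w y ≤ w (x ⊔ y) * w (x ⊓ y))
    (hXmono : MonotoneOn X (Function.support w))
    (hYmono : MonotoneOn Y (Function.support w))
    [IsProbabilityMeasure ((Measure.pi ρ).withDensity w)]
    (hXint : Integrable X ((Measure.pi ρ).withDensity w))
    (hYint : Integrable Y ((Measure.pi ρ).withDensity w))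
    (hXYint : Integrable (fun x ↦ X x * Y x) ((Measure.pi ρ).withDensity w)) :
    (∫ x, X x ∂(Measure.pi ρ).withDensity w) * ∫ x, Y x ∂(Measure.pi ρ).withDensity w
      ≤ ∫ x, X x * Y x ∂(Measure.pi ρ).withDensity w := by
  have habs (r : ℝ) (n : ℕ) : |max r (-n)| ≤ |r| := by
    have hn : (0 : ℝ) ≤ n := n.cast_nonneg
    exact abs_le.2 ⟨(neg_abs_le r).trans (le_max_left _ _),
      max_le (le_abs_self r) ((neg_nonpos.2 hn).trans (abs_nonneg r))⟩
  have hlim (r : ℝ) : Filter.Tendsto (fun n : ℕ ↦ max r (-n)) Filter.atTop (nhds r) := by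
    obtain ⟨N, hN⟩ := exists_nat_ge (-r)
    refine tendsto_const_nhds.congr' ?_
    filter_upwards [Filter.eventually_ge_atTop N] with n hn
    have hn' : (N : ℝ) ≤ n := Nat.cast_le.2 hn
    exact (max_eq_left (by linarith)).symm
  have hmeas {Z : (∀ i, π i) → ℝ} (hZ : Measurable Z) (n : ℕ) :
      Measurable fun x ↦ max (Z x) (-n) := hZ.max measurable_const
  have hmono {Z : (∀ i, π i) → ℝ} (hZ : MonotoneOn Z (Function.support w)) (n : ℕ) :
      MonotoneOn (fun x ↦ max (Z x) (-n)) (Function.support w) :=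
    fun x hx y hy hxy ↦ max_le_max_right _ (hZ hx hy hxy)
  set μ := (Measure.pi ρ).withDensity w
  have hint {Z : (∀ i, π i) → ℝ} (hZ : Measurable Z) (hZi : Integrable Z μ) (n : ℕ) :
      Integrable (fun x ↦ max (Z x) (-n)) μ :=
    hZi.mono (hmeas hZ n).aestronglyMeasurable (ae_of_all _ fun x ↦ habs _ _)
  have hbound (n : ℕ) (x) : ‖max (X x) (-n) * max (Y x) (-n)‖ ≤ ‖X x * Y x‖ := by
    rw [norm_mul, norm_mul]
    exact mul_le_mul (habs _ _) (habs _ _) (norm_nonneg _) (norm_nonneg _)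
  have htendsto {Z : (∀ i, π i) → ℝ} (hZ : Measurable Z) (hZi : Integrable Z μ) :
      Filter.Tendsto (fun n : ℕ ↦ ∫ x, max (Z x) (-n) ∂μ) Filter.atTop
        (nhds (∫ x, Z x ∂μ)) :=
    tendsto_integral_of_dominated_convergence (fun x ↦ ‖Z x‖)
      (fun n ↦ (hmeas hZ n).aestronglyMeasurable) hZi.norm
      (fun n ↦ ae_of_all _ fun x ↦ habs _ _) (ae_of_all _ fun x ↦ hlim _)
  have hmul (n : ℕ) : Measurable fun x ↦ max (X x) (-n) * max (Y x) (-n) :=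
    (hmeas hX n).mul (hmeas hY n)
  refine le_of_tendsto_of_tendsto' ((htendsto hX hXint).mul (htendsto hY hYint))
    (tendsto_integral_of_dominated_convergence (fun x ↦ ‖X x * Y x‖)
      (fun n ↦ (hmul n).aestronglyMeasurable) hXYint.norm
      (fun n ↦ ae_of_all _ (hbound n))
      (ae_of_all _ fun x ↦ (hlim (X x)).mul (hlim (Y x)))) fun n ↦ ?_
  exact fkg_integral_withDensity_of_le ρ hw (hmeas hX n) (hmeas hY n) hlattice
    (hmono hXmono n) (hmono hYmono n) (fun x ↦ le_max_right _ _) (fun x ↦ le_max_right _ _)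
    (hint hX hXint n) (hint hY hYint n)
    (hXYint.mono (hmul n).aestronglyMeasurable (ae_of_all _ (hbound n)))

end Pi

end MeasureTheory

/-- **FKG inequality from the lattice condition.**
If the probability measure `μ = s·ρ` (with `ρ = ⊗ ρ_e` a product of finite measures on
`(0,∞)`) has a density `s` satisfying the lattice condition
`s(κ ⊔ κ')·s(κ ⊓ κ') ≥ s(κ)·s(κ')` on `S = (0,∞)^E`, then for increasing measurable
`X, Y` with `X`, `Y`, `X·Y` integrable one has `μ(XY) ≥ μ(X)·μ(Y)`. -/
theorem fkg_from_lattice_condition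
    {E : Type*} [Fintype E]
    (ρ : E → Measure ℝ) [∀ e, IsFiniteMeasure (ρ e)]
    (hρsupp : ∀ e, ρ e (Set.Ioi (0 : ℝ))ᶜ = 0)
    (s : (E → ℝ) → ℝ)
    (hsmeas : Measurable s) (hsnonneg : ∀ κ, 0 ≤ s κ)
    (μ : Measure (E → ℝ))
    (hμ : μ = (Measure.pi ρ).withDensity fun κ => ENNReal.ofReal (s κ))
    [IsProbabilityMeasure μ]
    (hlattice : ∀ κ κ' : E → ℝ, (∀ e, 0 < κ e) → (∀ e, 0 < κ' e) →
      s κ * s κ' ≤ s (κ ⊔ κ') * s (κ ⊓ κ'))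
    (X Y : (E → ℝ) → ℝ) (hXmeas : Measurable X) (hYmeas : Measurable Y)
    (hXmono : ∀ κ κ' : E → ℝ, (∀ e, 0 < κ e) → (∀ e, 0 < κ' e) → κ ≤ κ' → X κ ≤ X κ')
    (hYmono : ∀ κ κ' : E → ℝ, (∀ e, 0 < κ e) → (∀ e, 0 < κ' e) → κ ≤ κ' → Y κ ≤ Y κ')
    (hXint : Integrable X μ) (hYint : Integrable Y μ)
    (hXYint : Integrable (fun κ => X κ * Y κ) μ) :
    (∫ κ, X κ ∂μ) * (∫ κ, Y κ ∂μ) ≤ ∫ κ, X κ * Y κ ∂μ := by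
  have hSmeas : MeasurableSet {κ : E → ℝ | ∀ e, 0 < κ e} := by
    simp only [Set.ofPred_forall]
    exact MeasurableSet.iInter fun e ↦ measurableSet_lt measurable_const (measurable_pi_apply e)
  set w : (E → ℝ) → ℝ≥0∞ :=
    {κ | ∀ e, 0 < κ e}.indicator fun κ ↦ ENNReal.ofReal (s κ) with hw
  have hwmeas : Measurable w := hsmeas.ennreal_ofReal.indicator hSmeas
  have hsupport {κ : E → ℝ} (hκ : κ ∈ Function.support w) : ∀ e, 0 < κ e :=
    Set.mem_of_indicator_ne_zero hκ
  have hpos : ∀ᵐ κ ∂Measure.pi ρ, ∀ e, 0 < κ e := by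
    rw [ae_all_iff]
    exact fun e ↦ Measure.tendsto_eval_ae_ae.eventually (hρsupp e)
  have hμw : μ = (Measure.pi ρ).withDensity w := by
    rw [hμ]
    refine withDensity_congr_ae ?_
    filter_upwards [hpos] with κ hκ
    rw [hw, Set.indicator_of_mem (s := {κ : E → ℝ | ∀ e, 0 < κ e}) hκ]
  have hlat (κ κ' : E → ℝ) : w κ * w κ' ≤ w (κ ⊔ κ') * w (κ ⊓ κ') := by
    by_cases hκ : ∀ e, 0 < κ e
    swap
    · simp [hw, Set.indicator, hκ]
    by_cases hκ' : ∀ e, 0 < κ' e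
    swap
    · simp [hw, Set.indicator, hκ']
    have hsup : ∀ e, 0 < (κ ⊔ κ') e := fun e ↦ lt_sup_of_lt_left (hκ e)
    have hinf : ∀ e, 0 < (κ ⊓ κ') e := fun e ↦ lt_inf_iff.2 ⟨hκ e, hκ' e⟩
    simp only [hw, Set.indicator, Set.mem_ofPred_eq, if_pos hκ, if_pos hκ', if_pos hsup,
      if_pos hinf]
    rw [← ENNReal.ofReal_mul (hsnonneg _), ← ENNReal.ofReal_mul (hsnonneg _)]
    exact ENNReal.ofReal_le_ofReal (hlattice κ κ' hκ hκ')
  clear_value w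
  subst hμw
  exact fkg_integral_withDensity ρ hwmeas hXmeas hYmeas hlat
    (fun κ hκ κ' hκ' ↦ hXmono κ κ' (hsupport hκ) (hsupport hκ'))
    (fun κ hκ κ' hκ' ↦ hYmono κ κ' (hsupport hκ) (hsupport hκ')) hXint hYint hXYint
end

section
/- Two-edge determinant inequality for weighted graph Laplacians: Let G = (V, E) be a finite connected graph, let f, g ∈ E be distinct edges, let 0 < c_f^− < c_f^+ and 0 < c_g^− < c_g^+, and let κ ∈ (0,∞)^E. Fix any vertex v₀ ∈ V and write D(κ) = det L(κ)[V∖{v₀}] for the reduced determinant of the weighted Laplacian. Then D(κ_{fg}^{++}) · D(κ_{fg}^{−−}) ≤ D(κ_{fg}^{+−}) · D(κ_{fg}^{−+}). -/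
open scoped Classical

/-- The weighted graph Laplacian of a finite graph `G` with conductances
`κ : Sym2 α → ℝ`: off-diagonal entries are `-κ {x,y}` on edges and `0` otherwise,
diagonal entries are the sums of the incident conductances. -/
noncomputable def glap {α : Type*} [Fintype α] (G : SimpleGraph α) (κ : Sym2 α → ℝ) :
    Matrix α α ℝ :=
  Matrix.of fun x y =>
    if x = y then ∑ z : α, (if G.Adj x z then κ s(x, z) else 0)
    else if G.Adj x y then -κ s(x, y) else 0

/-- The reduced determinant `det L(κ)[α∖W]`: the determinant of the principal submatrix
of the weighted Laplacian with rows and columns indexed by the complement of `W`. -/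
noncomputable def gdet {α : Type*} [Fintype α] (G : SimpleGraph α) (κ : Sym2 α → ℝ)
    (W : Set α) : ℝ :=
  ((glap G κ).submatrix (fun x : {x : α // x ∉ W} => (x : α))
    (fun x : {x : α // x ∉ W} => (x : α))).det

open Matrix in
/-- The determinant of a rank-two perturbation of an invertible symmetric matrix. -/
lemma det_add_smul_vecMulVec_add_smul_vecMulVec {n : Type*} [Fintype n] [DecidableEq n]
    (A : Matrix n n ℝ) (hA : A.IsSymm) (hdet : IsUnit A.det) (u v : n → ℝ) (a b : ℝ) :
    (A + a • vecMulVec u u + b • vecMulVec v v).det =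
      A.det * ((1 + a * (u ⬝ᵥ A⁻¹ *ᵥ u)) * (1 + b * (v ⬝ᵥ A⁻¹ *ᵥ v)) -
        a * b * (u ⬝ᵥ A⁻¹ *ᵥ v) ^ 2) := by
  have hUV : A + a • vecMulVec u u + b • vecMulVec v v =
      A + (of ![a • u, b • v])ᵀ * of ![u, v] := by
    ext i j
    simp [Matrix.mul_apply, Fin.sum_univ_two, vecMulVec_apply]
    ring
  have hentry (k l : Fin 2) : (of ![u, v] * A⁻¹ * (of ![a • u, b • v])ᵀ) k l =
      ![u, v] k ⬝ᵥ A⁻¹ *ᵥ ![a • u, b • v] l := by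
    rw [Matrix.mul_assoc]
    rfl
  have hsymm : v ⬝ᵥ A⁻¹ *ᵥ u = u ⬝ᵥ A⁻¹ *ᵥ v := by
    rw [dotProduct_mulVec, ← mulVec_transpose, transpose_nonsing_inv, hA.eq, dotProduct_comm]
  rw [hUV, det_add_mul _ _ hdet, det_fin_two]
  simp only [Matrix.add_apply, hentry]
  simp [mulVec_smul, hsymm]
  left
  ring

open Matrix in
/-- Submultiplicativity of the determinant under two nonnegative rank-one perturbations of a
symmetric matrix. -/
lemma det_rank_one_add_mul_det_le {n : Type*} [Fintype n] [DecidableEq n]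
    (A : Matrix n n ℝ) (hA : A.IsSymm) (u v : n → ℝ) {a b : ℝ} (ha : 0 ≤ a) (hb : 0 ≤ b) :
    (A + a • vecMulVec u u + b • vecMulVec v v).det * A.det ≤
      (A + a • vecMulVec u u).det * (A + b • vecMulVec v v).det := by
  have hunit (B : Matrix n n ℝ) (hB : B.IsSymm) (hdet : IsUnit B.det) :
      (B + a • vecMulVec u u + b • vecMulVec v v).det * B.det ≤
        (B + a • vecMulVec u u).det * (B + b • vecMulVec v v).det := by
    have hab := det_add_smul_vecMulVec_add_smul_vecMulVec B hB hdet u v a b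
    have ha0 := det_add_smul_vecMulVec_add_smul_vecMulVec B hB hdet u v a 0
    have h0b := det_add_smul_vecMulVec_add_smul_vecMulVec B hB hdet u v 0 b
    simp only [zero_smul, add_zero] at ha0 h0b
    rw [hab, ha0, h0b]
    have : 0 ≤ a * b * (B.det * (u ⬝ᵥ B⁻¹ *ᵥ v)) ^ 2 := by positivity
    linarith
  have hne : ∀ᶠ t : ℝ in nhdsWithin 0 {0}ᶜ, IsUnit (A + t • (1 : Matrix n n ℝ)).det := by
    have hfin := Polynomial.finite_setOfPred_isRoot (Matrix.charpoly_monic (-A)).ne_zero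
    filter_upwards [Filter.Eventually.filter_mono (nhdsNE_le_cofinite 0)
      hfin.compl_mem_cofinite] with t ht
    rw [isUnit_iff_ne_zero]
    intro h0
    apply ht
    change Polynomial.eval t _ = 0
    rw [Matrix.eval_charpoly, ← h0]
    congr 1
    rw [sub_neg_eq_add, add_comm, smul_one_eq_diagonal]
    rfl
  have hcont (B : Matrix n n ℝ) :
      Filter.Tendsto (fun t : ℝ => (B + t • (1 : Matrix n n ℝ)).det)
        (nhdsWithin 0 {0}ᶜ) (nhds B.det) := by
    have h : Continuous fun t : ℝ => (B + t • (1 : Matrix n n ℝ)).det :=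
      Continuous.matrix_det (by fun_prop)
    simpa using (h.tendsto 0).mono_left nhdsWithin_le_nhds
  refine le_of_tendsto_of_tendsto ((hcont _).mul (hcont _)) ((hcont _).mul (hcont _)) ?_
  filter_upwards [hne] with t ht
  have h := hunit (A + t • (1 : Matrix n n ℝ)) (hA.add (isSymm_one.smul t)) ht
  simpa only [add_right_comm] using h

lemma glap_isSymm {α : Type*} [Fintype α] (G : SimpleGraph α) (κ : Sym2 α → ℝ) :
    (glap G κ).IsSymm := by
  ext x y
  by_cases h : x = y
  · rw [h, Matrix.transpose_apply]
  · simp [glap, h, Ne.symm h, G.adj_comm y x, Sym2.eq_swap (a := y)]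

/-- Changing the conductance of one edge is a rank-one perturbation of the Laplacian. -/
lemma glap_update {α : Type*} [Fintype α] (G : SimpleGraph α) (κ : Sym2 α → ℝ)
    {p q : α} (hpq : G.Adj p q) (c : ℝ) :
    glap G (Function.update κ s(p, q) c) = glap G κ + (c - κ s(p, q)) •
      Matrix.vecMulVec (Pi.single p 1 - Pi.single q 1) (Pi.single p 1 - Pi.single q 1) := by
  have hne := hpq.ne
  ext x y
  by_cases hxy : x = y
  · subst hxy
    have hsum : ∑ z, (if G.Adj x z then Function.update κ s(p, q) c s(x, z) else 0) =
        ∑ z, ((if G.Adj x z then κ s(x, z) else 0) +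
          (if x = p then if z = q then c - κ s(p, q) else 0 else 0) +
          (if x = q then if z = p then c - κ s(p, q) else 0 else 0)) := by
      refine Finset.sum_congr rfl fun z _ => ?_
      have hqp := hpq.symm
      have hsw : s(q, p) = s(p, q) := Sym2.eq_swap
      simp only [Function.update_apply, Sym2.eq_iff]
      grind
    simp only [glap, Matrix.of_apply, if_true, hsum, Finset.sum_add_distrib, Matrix.add_apply,
      Matrix.smul_apply, Matrix.vecMulVec_apply, Pi.sub_apply, Pi.single_apply, smul_eq_mul]
    by_cases h1 : x = p <;> by_cases h2 : x = q <;> simp [h1, h2] <;> grind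
  · have hqp := hpq.symm
    have hsw : s(q, p) = s(p, q) := Sym2.eq_swap
    simp only [glap, Matrix.of_apply, if_neg hxy, Matrix.add_apply, Function.update_apply,
      Matrix.smul_apply, Matrix.vecMulVec_apply, Pi.sub_apply, Pi.single_apply, smul_eq_mul,
      Sym2.eq_iff]
    grind

/-- Changing the conductance of one edge is a rank-one perturbation of each principal submatrix
of the Laplacian. -/
lemma glap_update_submatrix {α : Type*} [Fintype α] (G : SimpleGraph α) (κ : Sym2 α → ℝ)
    (W : Set α) {p q : α} (hpq : G.Adj p q) (c : ℝ) :
    (glap G (Function.update κ s(p, q) c)).submatrix (fun x : {x : α // x ∉ W} => (x : α))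
      (fun x : {x : α // x ∉ W} => (x : α)) =
    (glap G κ).submatrix (fun x : {x : α // x ∉ W} => (x : α))
      (fun x : {x : α // x ∉ W} => (x : α)) + (c - κ s(p, q)) •
      Matrix.vecMulVec (fun x : {x : α // x ∉ W} => (Pi.single p 1 - Pi.single q 1 : α → ℝ) x)
        (fun x : {x : α // x ∉ W} => (Pi.single p 1 - Pi.single q 1 : α → ℝ) x) := by
  rw [glap_update G κ hpq c]
  rfl

/-- **Two-edge determinant inequality for weighted graph Laplacians**:
`D(κ_{fg}^{++})·D(κ_{fg}^{--}) ≤ D(κ_{fg}^{+-})·D(κ_{fg}^{-+})` where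
`D(κ) = det L(κ)[V∖{v₀}]`. -/
theorem two_edge_det_inequality
    {V : Type*} [Fintype V] (G : SimpleGraph V) (hconn : G.Connected)
    (f g : Sym2 V) (hf : f ∈ G.edgeSet) (hg : g ∈ G.edgeSet) (hfg : f ≠ g)
    (cfm cfp cgm cgp : ℝ)
    (hcf0 : 0 < cfm) (hcf : cfm < cfp) (hcg0 : 0 < cgm) (hcg : cgm < cgp)
    (κ : Sym2 V → ℝ) (hκpos : ∀ e ∈ G.edgeSet, 0 < κ e) (v₀ : V) :
    gdet G (Function.update (Function.update κ f cfp) g cgp) {v₀} *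
        gdet G (Function.update (Function.update κ f cfm) g cgm) {v₀}
      ≤ gdet G (Function.update (Function.update κ f cfp) g cgm) {v₀} *
          gdet G (Function.update (Function.update κ f cfm) g cgp) {v₀} := by
  induction f with | _ p q =>
  induction g with | _ r s =>
  rw [SimpleGraph.mem_edgeSet] at hf hg
  set κ₀ := Function.update (Function.update κ s(p, q) cfm) s(r, s) cgm with hκ₀
  have hκ₀f : κ₀ s(p, q) = cfm := by simp [hκ₀, hfg]
  have hκ₀g : κ₀ s(r, s) = cgm := by simp [hκ₀]
  have hpm : Function.update (Function.update κ s(p, q) cfp) s(r, s) cgm =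
      Function.update κ₀ s(p, q) cfp := by
    rw [hκ₀, Function.update_comm hfg.symm, Function.update_idem]
  have hmp : Function.update (Function.update κ s(p, q) cfm) s(r, s) cgp =
      Function.update κ₀ s(r, s) cgp := by
    rw [hκ₀, Function.update_idem]
  have hpp : Function.update (Function.update κ s(p, q) cfp) s(r, s) cgp =
      Function.update (Function.update κ₀ s(p, q) cfp) s(r, s) cgp := by
    rw [← hpm, Function.update_idem]
  rw [hpp, hpm, hmp]
  simp only [gdet, glap_update_submatrix G _ _ hf, glap_update_submatrix G _ _ hg,
    Function.update_of_ne hfg.symm, hκ₀f, hκ₀g]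
  exact det_rank_one_add_mul_det_le _ ((glap_isSymm G κ₀).submatrix _) _ _
    (sub_nonneg.2 hcf.le) (sub_nonneg.2 hcg.le)
end

section
/- Lattice condition for the reduced Laplacian determinant: Let G = (V, E) be a finite connected graph and fix v₀ ∈ V; write D(κ) = det L(κ)[V∖{v₀}]. Then for all κ, κ′ ∈ (0,∞)^E, D(κ ∨ κ′) · D(κ ∧ κ′) ≤ D(κ) · D(κ′). Equivalently, the density s_G(κ) = D(κ)^{−1/2} satisfies the FKG lattice condition s_G(κ ∨ κ′)·s_G(κ ∧ κ′) ≥ s_G(κ)·s_G(κ′). -/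
open scoped Classical

section

open Matrix

namespace Matrix

variable {n : Type*} [Fintype n] [DecidableEq n]

lemma det_add_vecMulVec_self {A : Matrix n n ℝ} (hA : A.PosDef) (v : n → ℝ) :
    (A + vecMulVec v v).det = A.det * (1 + v ⬝ᵥ (A⁻¹ *ᵥ v)) := by
  have hdet : IsUnit A.det := hA.det_pos.ne'.isUnit
  rw [vecMulVec_eq Unit, det_add_replicateCol_mul_replicateRow hdet, Matrix.mul_assoc,
    det_unique (n := Unit)]
  rfl

/-- The inverse of a positive definite matrix is antitone, as quadratic forms. -/
lemma dotProduct_inv_add_mulVec_le {A P : Matrix n n ℝ} (hA : A.PosDef) (hP : P.PosSemidef)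
    (v : n → ℝ) : v ⬝ᵥ ((A + P)⁻¹ *ᵥ v) ≤ v ⬝ᵥ (A⁻¹ *ᵥ v) := by
  have hAP := hA.add_posSemidef hP
  set x := A⁻¹ *ᵥ v with hx
  set y := (A + P)⁻¹ *ᵥ v with hy
  have hAx : A *ᵥ x = v := by
    rw [hx, mulVec_mulVec, mul_nonsing_inv _ hA.det_pos.ne'.isUnit, one_mulVec]
  have hAy : A *ᵥ y + P *ᵥ y = v := by
    rw [← add_mulVec, hy, mulVec_mulVec, mul_nonsing_inv _ hAP.det_pos.ne'.isUnit, one_mulVec]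
  have hsymm : x ⬝ᵥ (A *ᵥ y) = y ⬝ᵥ (A *ᵥ x) := by
    have hT : Aᵀ = A := by simpa using hA.isHermitian.eq
    rw [dotProduct_mulVec, ← mulVec_transpose, hT, dotProduct_comm]
  have hsq : 0 ≤ (x - y) ⬝ᵥ (A *ᵥ (x - y)) := by
    simpa using hA.posSemidef.dotProduct_mulVec_nonneg (x - y)
  have hPy : 0 ≤ y ⬝ᵥ (P *ᵥ y) := by simpa using hP.dotProduct_mulVec_nonneg y
  have hyv : y ⬝ᵥ (A *ᵥ y) + y ⬝ᵥ (P *ᵥ y) = y ⬝ᵥ v := by rw [← dotProduct_add, hAy]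
  rw [mulVec_sub, dotProduct_sub, sub_dotProduct, sub_dotProduct, hsymm, hAx] at hsq
  rw [dotProduct_comm v y, dotProduct_comm v x]
  linarith

/-- Log-submodularity of the determinant on positive definite matrices. -/
theorem det_add_add_mul_det_le {M P Q : Matrix n n ℝ} (hM : M.PosDef) (hP : P.PosSemidef)
    (hQ : Q.PosSemidef) : (M + P + Q).det * M.det ≤ (M + P).det * (M + Q).det := by
  obtain ⟨m, v, rfl⟩ := posSemidef_iff_eq_sum_vecMulVec.mp hQ
  simp only [star_trivial]
  have key : ∀ s : Finset (Fin m),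
      (M + P + ∑ i ∈ s, vecMulVec (v i) (v i)).det * M.det
        ≤ (M + P).det * (M + ∑ i ∈ s, vecMulVec (v i) (v i)).det := by
    intro s
    induction s using Finset.induction_on with
    | empty => simp
    | insert i s hi ih =>
      have hS : (∑ i ∈ s, vecMulVec (v i) (v i)).PosSemidef :=
        posSemidef_sum s fun i _ => by simpa using posSemidef_vecMulVec_self_star (v i)
      have hMS := hM.add_posSemidef hS
      have hMSP := hMS.add_posSemidef hP
      have hMPS := (hM.add_posSemidef hP).add_posSemidef hS
      have hMP := (hM.add_posSemidef hP).det_pos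
      have hle := dotProduct_inv_add_mulVec_le hMS hP (v i)
      rw [add_right_comm] at hle
      have hnn : 0 ≤ v i ⬝ᵥ ((M + P + ∑ i ∈ s, vecMulVec (v i) (v i))⁻¹ *ᵥ v i) := by
        simpa using hMPS.inv.posSemidef.dotProduct_mulVec_nonneg (v i)
      rw [Finset.sum_insert hi, add_comm (vecMulVec (v i) (v i)), ← add_assoc, ← add_assoc,
        det_add_vecMulVec_self hMPS, det_add_vecMulVec_self hMS, mul_right_comm, ← mul_assoc]
      have hMSdet := hMS.det_pos
      gcongr
  exact key Finset.univ

end Matrix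

section Laplacian

variable {V : Type*} [Fintype V] (G : SimpleGraph V)

lemma glap_add (κ κ' : Sym2 V → ℝ) : glap G (κ + κ') = glap G κ + glap G κ' := by
  ext x y
  simp only [glap, of_apply, Matrix.add_apply, Pi.add_apply]
  split_ifs
  · rw [← Finset.sum_add_distrib]
    exact Finset.sum_congr rfl fun z _ => by split_ifs <;> simp
  · ring
  · simp

lemma glap_isHermitian (κ : Sym2 V → ℝ) : (glap G κ).IsHermitian := by
  ext x y
  by_cases h : x = y
  · subst h; simp
  · simp [glap, h, Ne.symm h, G.adj_comm, Sym2.eq_swap]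

/-- The Dirichlet form of the weighted Laplacian. -/
lemma dotProduct_glap_mulVec (κ : Sym2 V → ℝ) (f : V → ℝ) :
    f ⬝ᵥ (glap G κ *ᵥ f) =
      (∑ x, ∑ y, if G.Adj x y then κ s(x, y) * (f x - f y) ^ 2 else 0) / 2 := by
  set w : V → V → ℝ := fun x y => if G.Adj x y then κ s(x, y) else 0 with hw
  have hwsymm (x y : V) : w x y = w y x := by simp [hw, G.adj_comm, Sym2.eq_swap]
  have hglap (x y : V) : glap G κ x y = (if x = y then ∑ z, w x z else 0) - w x y := by
    by_cases h : x = y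
    · subst h; simp [glap, hw]
    · by_cases h' : G.Adj x y <;> simp [glap, hw, h, h']
  have hterm (x y : V) : (if G.Adj x y then κ s(x, y) * (f x - f y) ^ 2 else 0)
      = w x y * f x ^ 2 + w x y * f y ^ 2 - 2 * (f x * w x y * f y) := by
    simp only [hw]; split_ifs <;> ring
  have hleft : f ⬝ᵥ (glap G κ *ᵥ f)
      = ∑ x, ∑ y, w x y * f x ^ 2 - ∑ x, ∑ y, f x * w x y * f y := by
    rw [← Finset.sum_sub_distrib]
    refine Finset.sum_congr rfl fun x _ => ?_
    simp only [mulVec, dotProduct, hglap, sub_mul, ite_mul, zero_mul, Finset.sum_sub_distrib,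
      Finset.sum_ite_eq, Finset.mem_univ, if_true, mul_sub, Finset.mul_sum, Finset.sum_mul]
    congr 1 <;> exact Finset.sum_congr rfl fun y _ => by ring
  have hswap : ∑ x, ∑ y, w x y * f y ^ 2 = ∑ x, ∑ y, w x y * f x ^ 2 := by
    rw [Finset.sum_comm]
    exact Finset.sum_congr rfl fun x _ => Finset.sum_congr rfl fun y _ => by rw [hwsymm]
  simp only [hterm, Finset.sum_sub_distrib, Finset.sum_add_distrib, ← Finset.mul_sum]
  rw [hleft, hswap]
  ring

lemma glap_posSemidef {κ : Sym2 V → ℝ} (hκ : ∀ e ∈ G.edgeSet, 0 ≤ κ e) :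
    (glap G κ).PosSemidef := by
  refine .of_dotProduct_mulVec_nonneg (glap_isHermitian G κ) fun f => ?_
  rw [star_trivial, dotProduct_glap_mulVec]
  refine div_nonneg (Finset.sum_nonneg fun x _ => Finset.sum_nonneg fun y _ => ?_) two_pos.le
  split_ifs with h
  · exact mul_nonneg (hκ _ h) (sq_nonneg _)
  · exact le_rfl

variable {G}

/-- The kernel of the weighted Laplacian of a connected graph consists of constants. -/
lemma eq_of_dotProduct_glap_mulVec_eq_zero (hconn : G.Connected) {κ : Sym2 V → ℝ}
    (hκ : ∀ e ∈ G.edgeSet, 0 < κ e) {f : V → ℝ} (hf : f ⬝ᵥ (glap G κ *ᵥ f) = 0) (x y : V) :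
    f x = f y := by
  have hnn (x y : V) : 0 ≤ if G.Adj x y then κ s(x, y) * (f x - f y) ^ 2 else 0 := by
    split_ifs with h
    · exact mul_nonneg (hκ _ h).le (sq_nonneg _)
    · exact le_rfl
  rw [dotProduct_glap_mulVec, div_eq_zero_iff, or_iff_left two_ne_zero,
    Finset.sum_eq_zero_iff_of_nonneg fun x _ => Finset.sum_nonneg fun y _ => hnn x y] at hf
  have hadj {x y : V} (h : G.Adj x y) : f x = f y := by
    have h0 := (Finset.sum_eq_zero_iff_of_nonneg fun y _ => hnn x y).mp
      (hf x (Finset.mem_univ x)) y (Finset.mem_univ y)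
    rw [if_pos h, mul_eq_zero, or_iff_right (hκ _ h).ne'] at h0
    exact sub_eq_zero.mp (pow_eq_zero_iff two_ne_zero |>.mp h0)
  obtain ⟨p⟩ := hconn.preconnected x y
  induction p with
  | nil => rfl
  | cons h _ ih => exact (hadj h).trans ih

lemma reduced_glap_posDef (hconn : G.Connected) (v₀ : V) {κ : Sym2 V → ℝ}
    (hκ : ∀ e ∈ G.edgeSet, 0 < κ e) :
    ((glap G κ).submatrix (fun x : {x : V // x ∉ ({v₀} : Set V)} => (x : V))
      (fun x : {x : V // x ∉ ({v₀} : Set V)} => (x : V))).PosDef := by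
  have hpsd := glap_posSemidef G fun e he => (hκ e he).le
  refine .of_dotProduct_mulVec_pos (hpsd.submatrix _).isHermitian fun f hf => ?_
  set g : V → ℝ := fun x => if h : x ∉ ({v₀} : Set V) then f ⟨x, h⟩ else 0 with hg
  have hgf (x : {x : V // x ∉ ({v₀} : Set V)}) : g x = f x := dif_pos x.2
  have hg₀ : g v₀ = 0 := by simp [hg]
  have hsum (F : V → ℝ) (hF : F v₀ = 0) :
      ∑ x : {x : V // x ∉ ({v₀} : Set V)}, F x = ∑ x, F x := by
    rw [← Finset.sum_subtype (Finset.univ.erase v₀) (by simp) F, Finset.sum_erase _ hF]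
  have hform : star f ⬝ᵥ ((glap G κ).submatrix
      (fun x : {x : V // x ∉ ({v₀} : Set V)} => (x : V))
      (fun x : {x : V // x ∉ ({v₀} : Set V)} => (x : V)) *ᵥ f) = g ⬝ᵥ (glap G κ *ᵥ g) := by
    simp only [star_trivial, dotProduct, mulVec, submatrix_apply, ← hgf]
    rw [← hsum _ (by simp [hg₀])]
    refine Finset.sum_congr rfl fun x _ => ?_
    rw [← hsum _ (by simp [hg₀])]
  rw [hform]
  refine lt_of_le_of_ne (by simpa using hpsd.dotProduct_mulVec_nonneg g) fun h0 => hf ?_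
  ext x
  rw [← hgf, eq_of_dotProduct_glap_mulVec_eq_zero hconn hκ h0.symm x v₀, hg₀, Pi.zero_apply]

end Laplacian

end

/-- **Lattice condition for the reduced Laplacian determinant**:
`D(κ ∨ κ')·D(κ ∧ κ') ≤ D(κ)·D(κ')`, and equivalently the density
`s_G(κ) = D(κ)^{-1/2}` satisfies the FKG lattice condition
`s_G(κ ∨ κ')·s_G(κ ∧ κ') ≥ s_G(κ)·s_G(κ')`. -/
theorem reduced_det_lattice_condition
    {V : Type*} [Fintype V] (G : SimpleGraph V) (hconn : G.Connected) (v₀ : V)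
    (κ κ' : Sym2 V → ℝ)
    (hκpos : ∀ e ∈ G.edgeSet, 0 < κ e) (hκ'pos : ∀ e ∈ G.edgeSet, 0 < κ' e) :
    gdet G (κ ⊔ κ') {v₀} * gdet G (κ ⊓ κ') {v₀} ≤ gdet G κ {v₀} * gdet G κ' {v₀}
    ∧
    (Real.sqrt (gdet G κ {v₀}))⁻¹ * (Real.sqrt (gdet G κ' {v₀}))⁻¹
      ≤ (Real.sqrt (gdet G (κ ⊔ κ') {v₀}))⁻¹ * (Real.sqrt (gdet G (κ ⊓ κ') {v₀}))⁻¹ := by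
  have hpos {k : Sym2 V → ℝ} (hk : ∀ e ∈ G.edgeSet, 0 < k e) : 0 < gdet G k {v₀} :=
    (reduced_glap_posDef hconn v₀ hk).det_pos
  have hinf : ∀ e ∈ G.edgeSet, 0 < (κ ⊓ κ') e := fun e he =>
    lt_inf_iff.mpr ⟨hκpos e he, hκ'pos e he⟩
  have hsup : κ ⊔ κ' = κ ⊓ κ' + (κ - κ ⊓ κ') + (κ' - κ ⊓ κ') := by
    rw [add_sub_cancel, ← add_sub_assoc, eq_sub_iff_add_eq, add_comm, inf_add_sup]
  have hdet : gdet G (κ ⊔ κ') {v₀} * gdet G (κ ⊓ κ') {v₀}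
      ≤ gdet G κ {v₀} * gdet G κ' {v₀} := by
    have h := Matrix.det_add_add_mul_det_le (reduced_glap_posDef hconn v₀ hinf)
      ((glap_posSemidef G (κ := κ - κ ⊓ κ')
        fun e _ => sub_nonneg.mpr inf_le_left).submatrix
          fun x : {x : V // x ∉ ({v₀} : Set V)} => (x : V))
      ((glap_posSemidef G (κ := κ' - κ ⊓ κ')
        fun e _ => sub_nonneg.mpr inf_le_right).submatrix
          fun x : {x : V // x ∉ ({v₀} : Set V)} => (x : V))
    simp only [← Matrix.submatrix_add, ← Pi.add_apply, ← glap_add] at h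
    rw [← hsup, add_sub_cancel, add_sub_cancel] at h
    exact h
  refine ⟨hdet, ?_⟩
  have hsupdet : 0 < gdet G (κ ⊔ κ') {v₀} := hpos fun e he => lt_sup_of_lt_left (hκpos e he)
  have hprod := mul_pos hsupdet (hpos hinf)
  rw [← mul_inv, ← mul_inv, ← Real.sqrt_mul (hpos hκpos).le, ← Real.sqrt_mul hsupdet.le]
  gcongr
end
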